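/- arXiv:1101.3267 — 2 statements merged into one kernel-verified Lean document; each statement's English description precedes it below -/
import Mathlib

section
/- Let A be an integer (r,s)×t bimatrix and let g = (g¹,…,gⁿ) ∈ 𝒢(A⁽ⁿ⁾). Suppose that for each i = 1,…,n the brick gⁱ is written as a conformal sum gⁱ = Σ_{j=1}^{k_i} h^{i,j} with each h^{i,j} ∈ 𝒢(A₂) and h^{i,j} ⊑ gⁱ. Let m := k₁+⋯+k_n and let h := (h^{1,1},…,h^{1,k₁},…,h^{n,1},…,h^{n,k_n}) ∈ ℤ^{mt}. Then h is an element of the Graver basis 𝒢(A⁽ᵐ⁾) of the m-fold product of A. -/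
open Matrix

/-- The conformal (sign-compatible) partial order `x ⊑ y` on integer vectors:
`x k * y k ≥ 0` and `|x k| ≤ |y k|` for every coordinate `k`. -/
def ConformalLe {ν : Type*} (x y : ν → ℤ) : Prop :=
  ∀ k, 0 ≤ x k * y k ∧ |x k| ≤ |y k|

/-- The Graver basis of an integer matrix `A`: the set of `⊑`-minimal elements of
`{x : A x = 0, x ≠ 0}`. -/
def GraverBasis {μ ν : Type*} [Fintype ν] (A : Matrix μ ν ℤ) : Set (ν → ℤ) :=
  {x | A.mulVec x = 0 ∧ x ≠ 0 ∧
    ∀ y, A.mulVec y = 0 → y ≠ 0 → ConformalLe y x → y = x}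

/-- The `ι`-fold product of the bimatrix with blocks `A1` (first block, `r × τ`) and
`A2` (second block, `s × τ`): the first `r` rows are `(A1 A1 ⋯ A1)` and the remaining
rows form a block-diagonal matrix with a copy of `A2` for each index in `ι`. -/
def nFold {r s : ℕ} {τ : Type*} (A1 : Matrix (Fin r) τ ℤ) (A2 : Matrix (Fin s) τ ℤ)
    (ι : Type*) [DecidableEq ι] : Matrix (Fin r ⊕ ι × Fin s) (ι × τ) ℤ :=
  Matrix.of fun i jt =>
    match i with
    | Sum.inl a => A1 a jt.2
    | Sum.inr (k, c) => if jt.1 = k then A2 c jt.2 else 0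

/-- The `i`-th brick of a vector indexed by `ι × τ`. -/
def brick {ι τ : Type*} (x : ι × τ → ℤ) (i : ι) : τ → ℤ := fun j => x (i, j)

/-- The Graver complexity of the bimatrix `(A1, A2)`: the largest number of nonzero
bricks appearing in any element of the Graver basis of any `n`-fold product. -/
noncomputable def graverComplexity {r s t : ℕ} (A1 : Matrix (Fin r) (Fin t) ℤ)
    (A2 : Matrix (Fin s) (Fin t) ℤ) : ℕ :=
  sSup {k : ℕ | ∃ (n : ℕ) (g : Fin n × Fin t → ℤ),
    g ∈ GraverBasis (nFold A1 A2 (Fin n)) ∧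
    k = {i : Fin n | brick g i ≠ 0}.ncard}

/-- `Z(A)`: the set of all vectors in `ℤ^t` that are sums of at most `g(A)` elements
of the Graver basis of `A2`. -/
noncomputable def ZSet {r s t : ℕ} (A1 : Matrix (Fin r) (Fin t) ℤ)
    (A2 : Matrix (Fin s) (Fin t) ℤ) : Set (Fin t → ℤ) :=
  {z | ∃ L : List (Fin t → ℤ), L.length ≤ graverComplexity A1 A2 ∧
    (∀ h ∈ L, h ∈ GraverBasis A2) ∧ z = L.sum}

theorem conformalLe_iff {ν : Type*} {x y : ν → ℤ} :
    ConformalLe x y ↔ ∀ k, (0 ≤ x k ∧ x k ≤ y k) ∨ (y k ≤ x k ∧ x k ≤ 0) := by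
  refine forall_congr' fun k => ⟨fun ⟨h1, h2⟩ => ?_, ?_⟩
  · rcases le_total 0 (y k) with hy | hy
    · refine Or.inl ?_
      rw [abs_of_nonneg hy] at h2
      refine ⟨?_, (abs_le.1 h2).2⟩
      by_contra! hx
      nlinarith [(abs_le.1 h2).1]
    · refine Or.inr ?_
      rw [abs_of_nonpos hy] at h2
      refine ⟨by linarith [(abs_le.1 h2).1], ?_⟩
      by_contra! hx
      nlinarith [(abs_le.1 h2).2]
  · rintro (⟨h1, h2⟩ | ⟨h1, h2⟩)
    · exact ⟨mul_nonneg h1 (h1.trans h2), abs_le_abs_of_nonneg h1 h2⟩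
    · exact ⟨mul_nonneg_of_nonpos_of_nonpos h2 (h1.trans h2), abs_le_abs_of_nonpos h2 h1⟩

/-- A family conformal to a conformal decomposition is, in each coordinate, squeezed between
zero and the decomposition with a common sign. -/
theorem ConformalLe.forall_sign {κ ν : Type*} {a b : κ → ν → ℤ} {c : ν → ℤ}
    (hab : ∀ j, ConformalLe (a j) (b j)) (hbc : ∀ j, ConformalLe (b j) c) (l : ν) :
    (∀ j, 0 ≤ a j l ∧ a j l ≤ b j l) ∨ (∀ j, b j l ≤ a j l ∧ a j l ≤ 0) := by
  simp only [conformalLe_iff] at hab hbc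
  rcases le_total 0 (c l) with hc | hc
  · refine Or.inl fun j => ?_
    have := hab j l
    have := hbc j l
    omega
  · refine Or.inr fun j => ?_
    have := hab j l
    have := hbc j l
    omega

section ConformalSum

variable {κ ν : Type*} [Fintype κ] {a b : κ → ν → ℤ} {c : ν → ℤ}

theorem conformalLe_sum (hab : ∀ j, ConformalLe (a j) (b j)) (hbc : ∀ j, ConformalLe (b j) c)
    (hc : c = ∑ j, b j) : ConformalLe (∑ j, a j) c := by
  rw [conformalLe_iff]
  intro l
  rw [hc]
  simp only [Finset.sum_apply]
  exact (ConformalLe.forall_sign hab hbc l).imp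
    (fun h => ⟨Finset.sum_nonneg fun j _ => (h j).1, Finset.sum_le_sum fun j _ => (h j).2⟩)
    (fun h => ⟨Finset.sum_le_sum fun j _ => (h j).1, Finset.sum_nonpos fun j _ => (h j).2⟩)

theorem eq_zero_of_conformalLe_of_sum_eq_zero (hab : ∀ j, ConformalLe (a j) (b j))
    (hbc : ∀ j, ConformalLe (b j) c) (ha : ∑ j, a j = 0) (j : κ) : a j = 0 := by
  ext l
  have hl : ∑ j, a j l = 0 := by simpa using congrFun ha l
  rcases ConformalLe.forall_sign hab hbc l with h | h
  · exact (Finset.sum_eq_zero_iff_of_nonneg fun j _ => (h j).1).1 hl j (Finset.mem_univ j)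
  · exact (Finset.sum_eq_zero_iff_of_nonpos fun j _ => (h j).2).1 hl j (Finset.mem_univ j)

theorem eq_of_conformalLe_of_sum_eq_sum (hab : ∀ j, ConformalLe (a j) (b j))
    (hbc : ∀ j, ConformalLe (b j) c) (h : ∑ j, a j = ∑ j, b j) (j : κ) : a j = b j := by
  ext l
  have hl : ∑ j, a j l = ∑ j, b j l := by simpa using congrFun h l
  rcases ConformalLe.forall_sign hab hbc l with h | h
  · exact (Finset.sum_eq_sum_iff_of_le fun j _ => (h j).2).1 hl j (Finset.mem_univ j)
  · exact ((Finset.sum_eq_sum_iff_of_le fun j _ => (h j).1).1 hl.symm j (Finset.mem_univ j)).symm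

end ConformalSum

theorem nFold_mulVec_eq_zero_iff {r s : ℕ} {τ ι : Type*} [Fintype τ] [Fintype ι] [DecidableEq ι]
    (A1 : Matrix (Fin r) τ ℤ) (A2 : Matrix (Fin s) τ ℤ) (x : ι × τ → ℤ) :
    (nFold A1 A2 ι).mulVec x = 0 ↔
      A1.mulVec (∑ i, brick x i) = 0 ∧ ∀ i, A2.mulVec (brick x i) = 0 := by
  have h1 (a : Fin r) : (nFold A1 A2 ι).mulVec x (Sum.inl a) = A1.mulVec (∑ i, brick x i) a := by
    simp only [Matrix.mulVec, dotProduct, nFold, brick, Fintype.sum_prod_type, Matrix.of_apply,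
      Finset.sum_apply, Finset.mul_sum]
    exact Finset.sum_comm
  have h2 (i : ι) (c : Fin s) :
      (nFold A1 A2 ι).mulVec x (Sum.inr (i, c)) = A2.mulVec (brick x i) c := by
    simp only [Matrix.mulVec, dotProduct, nFold, brick, Fintype.sum_prod_type, Matrix.of_apply]
    rw [Finset.sum_eq_single i] <;> simp +contextual
  simp only [funext_iff, Sum.forall, Prod.forall, h1, h2, Pi.zero_apply]

/-- If `g ∈ 𝒢(A⁽ⁿ⁾)` and each brick `gⁱ` is written as a conformal sum
`gⁱ = ∑_{j=1}^{kᵢ} h^{i,j}` of elements `h^{i,j} ∈ 𝒢(A₂)` with `h^{i,j} ⊑ gⁱ`, then the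
vector `h` whose bricks are all the `h^{i,j}` (indexed by `Σ i, Fin (kᵢ)`, of total
number `m = k₁ + ⋯ + kₙ`) is an element of the Graver basis of the `m`-fold product. -/
theorem concatenated_decomposition_mem_graverBasis {r s t : ℕ}
    (A1 : Matrix (Fin r) (Fin t) ℤ) (A2 : Matrix (Fin s) (Fin t) ℤ)
    (n : ℕ) (g : Fin n × Fin t → ℤ) (hg : g ∈ GraverBasis (nFold A1 A2 (Fin n)))
    (k : Fin n → ℕ) (h : (i : Fin n) → Fin (k i) → (Fin t → ℤ))
    (hmem : ∀ i j, h i j ∈ GraverBasis A2)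
    (hconf : ∀ i j, ConformalLe (h i j) (brick g i))
    (hsum : ∀ i, brick g i = ∑ j, h i j) :
    (fun p : (Σ i : Fin n, Fin (k i)) × Fin t => h p.1.1 p.1.2 p.2)
      ∈ GraverBasis (nFold A1 A2 (Σ i : Fin n, Fin (k i))) := by
  classical
  obtain ⟨hg0, hgne, hgmin⟩ := hg
  rw [nFold_mulVec_eq_zero_iff] at hg0
  refine ⟨?_, ?_, fun y hy hyne hyh => ?_⟩
  · rw [nFold_mulVec_eq_zero_iff]
    refine ⟨?_, fun p => (hmem p.1 p.2).1⟩
    rw [Fintype.sum_sigma, ← hg0.1]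
    exact congrArg _ (Finset.sum_congr rfl fun i _ => (hsum i).symm)
  · intro h0
    apply hgne
    have hz (i j) : h i j = 0 := funext fun l => congrFun h0 (⟨i, j⟩, l)
    ext ⟨i, l⟩
    simpa [hz, brick] using congrFun (hsum i) l
  · rw [nFold_mulVec_eq_zero_iff, Fintype.sum_sigma] at hy
    have hyc (i) (j : Fin (k i)) : ConformalLe (brick y ⟨i, j⟩) (h i j) :=
      fun l => hyh (⟨i, j⟩, l)
    let z : Fin n × Fin t → ℤ := fun q => (∑ j, brick y ⟨q.1, j⟩) q.2
    have hz (i) : brick z i = ∑ j, brick y ⟨i, j⟩ := rfl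
    have hzg : z = g := by
      refine hgmin z ?_ ?_ fun q => conformalLe_sum (hyc q.1) (hconf q.1) (hsum q.1) q.2
      · rw [nFold_mulVec_eq_zero_iff]
        refine ⟨hy.1, fun i => ?_⟩
        rw [hz, Matrix.mulVec_sum]
        exact Finset.sum_eq_zero fun j _ => hy.2 ⟨i, j⟩
      · intro hz0
        apply hyne
        ext ⟨⟨i, j⟩, l⟩
        have hi : ∑ j, brick y ⟨i, j⟩ = 0 := by rw [← hz, hz0]; rfl
        exact congrFun (eq_zero_of_conformalLe_of_sum_eq_zero (hyc i) (hconf i) hi j) l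
    ext ⟨⟨i, j⟩, l⟩
    have hi : ∑ j, brick y ⟨i, j⟩ = ∑ j, h i j := by rw [← hz, hzg, hsum]
    exact congrFun (eq_of_conformalLe_of_sum_eq_sum (hyc i) (hconf i) hi j) l
end

section
/- (Conformal sum property of Graver bases.) Let A be an integer m×N matrix and let x ∈ ℤ^N be nonzero with Ax = 0. Then x can be written as a finite sum x = Σ_{j=1}^k hⱼ with each hⱼ an element of the Graver basis 𝒢(A) satisfying hⱼ ⊑ x. -/
open Matrix

theorem ConformalLe.trans {ν : Type*} {x y z : ν → ℤ} (hxy : ConformalLe x y)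
    (hyz : ConformalLe y z) : ConformalLe x z := by
  intro k
  obtain ⟨h₁, h₂⟩ := hxy k
  obtain ⟨h₃, h₄⟩ := hyz k
  refine ⟨?_, h₂.trans h₄⟩
  rcases eq_or_ne (y k) 0 with hy | hy
  · have : x k = 0 := by simpa [hy] using h₂
    simp [this]
  · refine nonneg_of_mul_nonneg_left (b := y k * y k) ?_ (mul_self_pos.mpr hy)
    calc 0 ≤ (x k * y k) * (y k * z k) := mul_nonneg h₁ h₃
      _ = x k * z k * (y k * y k) := by ring

theorem ConformalLe.refl {ν : Type*} (x : ν → ℤ) : ConformalLe x x :=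
  fun k => ⟨mul_self_nonneg (x k), le_rfl⟩

theorem ConformalLe.abs_sub {ν : Type*} {x y : ν → ℤ} (h : ConformalLe y x) (k : ν) :
    |x k - y k| = |x k| - |y k| := by
  obtain ⟨h₁, h₂⟩ := h k
  rcases mul_nonneg_iff.mp h₁ with ⟨hy, hx⟩ | ⟨hy, hx⟩
  · rw [abs_of_nonneg hy, abs_of_nonneg hx] at *
    exact abs_of_nonneg (by lia)
  · rw [abs_of_nonpos hy, abs_of_nonpos hx] at *
    rw [abs_of_nonpos (by lia)]
    ring

theorem ConformalLe.sub {ν : Type*} {x y : ν → ℤ} (h : ConformalLe y x) :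
    ConformalLe (x - y) x := by
  intro k
  have habs := h.abs_sub k
  refine ⟨?_, ?_⟩
  · have hle : y k * x k ≤ x k * x k := by
      calc y k * x k ≤ |y k * x k| := le_abs_self _
        _ = |y k| * |x k| := abs_mul _ _
        _ ≤ |x k| * |x k| := mul_le_mul_of_nonneg_right (h k).2 (abs_nonneg _)
        _ = x k * x k := abs_mul_abs_self _
    simpa [sub_mul] using hle
  · have := abs_nonneg (y k)
    simp only [Pi.sub_apply]
    lia

theorem ConformalLe.sum_natAbs_add {ν : Type*} [Fintype ν] {x y : ν → ℤ}
    (h : ConformalLe y x) :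
    ∑ k, (y k).natAbs + ∑ k, ((x - y) k).natAbs = ∑ k, (x k).natAbs := by
  rw [← Finset.sum_add_distrib]
  refine Finset.sum_congr rfl fun k _ => ?_
  have := h.abs_sub k
  simp only [Pi.sub_apply]
  zify
  lia

theorem sum_natAbs_pos {ν : Type*} [Fintype ν] {x : ν → ℤ} (hx : x ≠ 0) :
    0 < ∑ k, (x k).natAbs := by
  obtain ⟨k, hk⟩ := Function.ne_iff.mp hx
  exact Finset.sum_pos' (fun _ _ => Nat.zero_le _)
    ⟨k, Finset.mem_univ k, Int.natAbs_pos.mpr hk⟩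

/-- **conformal sum property of Graver bases.** Every nonzero integer
vector `x` with `A x = 0` is a finite sum `x = ∑_{j=1}^k hⱼ` of Graver basis elements
`hⱼ ∈ 𝒢(A)` with `hⱼ ⊑ x`. -/
theorem conformal_sum_graver {m N : ℕ} (A : Matrix (Fin m) (Fin N) ℤ)
    (x : Fin N → ℤ) (hx0 : x ≠ 0) (hx : A.mulVec x = 0) :
    ∃ (k : ℕ) (h : Fin k → (Fin N → ℤ)),
      (∀ j, h j ∈ GraverBasis A) ∧ (∀ j, ConformalLe (h j) x) ∧ x = ∑ j, h j := by
  induction hn : ∑ k, (x k).natAbs using Nat.strong_induction_on generalizing x with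
  | _ n ih =>
    by_cases hG : x ∈ GraverBasis A
    · exact ⟨1, fun _ => x, fun _ => hG, fun _ => ConformalLe.refl x, by simp⟩
    · obtain ⟨y, hy, hy0, hyx, hne⟩ :
          ∃ y, A.mulVec y = 0 ∧ y ≠ 0 ∧ ConformalLe y x ∧ y ≠ x := by
        by_contra! hcon
        exact hG ⟨hx, hx0, hcon⟩
      have hz0 : x - y ≠ 0 := sub_ne_zero.mpr hne.symm
      have hadd := hyx.sum_natAbs_add
      have hypos := sum_natAbs_pos hy0
      have hzpos := sum_natAbs_pos hz0
      obtain ⟨p, f, hfG, hfy, hf⟩ := ih _ (by lia) y hy0 hy rfl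
      obtain ⟨q, g, hgG, hgz, hg⟩ :=
        ih _ (by lia) (x - y) hz0 (by rw [Matrix.mulVec_sub, hx, hy, sub_zero]) rfl
      refine ⟨p + q, Fin.append f g, fun j => ?_, fun j => ?_, ?_⟩
      · refine Fin.addCases (fun i => ?_) (fun i => ?_) j
        · simpa using hfG i
        · simpa using hgG i
      · refine Fin.addCases (fun i => ?_) (fun i => ?_) j
        · simpa using (hfy i).trans hyx
        · simpa using (hgz i).trans hyx.sub
      · simp only [Fin.sum_univ_add, Fin.append_left, Fin.append_right]
        rw [← hf, ← hg, add_sub_cancel]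
end
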